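/- There exist constants C₁ > 0 and θ ∈ (0,1) such that for every k ≥ 2, every real L ≥ 1, and all positive integers i₁ < i₂ < ⋯ < i_k, the SCF digits satisfy μ{ x ∈ (0,1) irrational : min_{1≤j≤k} a_{i_j}(x) > L } ≤ ∏_{j=1}^{k−1} (1 + C₁ θ^{i_{j+1}−i_j}) · ∏_{j=1}^{k} μ{ x : a_{i_j}(x) > L }. -/

import Mathlib

open MeasureTheory Real Set Filter Topology

namespace SCF

/-- The involution `ι(x) = (1−x)/(1+x)`. -/
noncomputable def iota (x : ℝ) : ℝ := (1 - x) / (1 + x)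

/-- Even continued-fraction step.  For `y ∈ (0,1/2]` one has
`⌊(1/y+1)/2⌋ = k` whenever `1/y ∈ (2k−1, 2k+1)`, so `Te y = |1/y − 2k|`;
explicitly `Te y = 1/y − 2` on `[1/3,1/2]`, `Te y = 1/y − 2k` on
`[1/(2k+1), 1/(2k))` and `Te y = 2k − 1/y` on `[1/(2k), 1/(2k−1))` (`k ≥ 2`). -/
noncomputable def Te (y : ℝ) : ℝ := |1 / y - 2 * (⌊(1 / y + 1) / 2⌋ : ℝ)|

/-- The spliced continued fraction (SCF) map `T : [0,1] → [0,1]`, with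
`T 0 = 0`, `T 1 = 1`.  On `(0,1/2]` it is the even continued fraction map
(see `Te`), and on `(1/2,1)` it is the odd–odd map, which is the conjugate
`ι ∘ Te ∘ ι` of the even map; this agrees with the branchwise definition:
`T x = (k x − (k−1))/(k − (k+1) x)` on `((k−1)/k, (2k−1)/(2k+1)]` and
`T x = (k − (k+1) x)/(k x − (k−1))` on `((2k−1)/(2k+1), k/(k+1)]` for `k ≥ 2`. -/
noncomputable def T (x : ℝ) : ℝ :=
  if x ≤ 0 then 0
  else if 1 ≤ x then 1
  else if x ≤ 1 / 2 then Te x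
  else iota (Te (iota x))

/-- Parity label of a digit: `e` (even cusp) or `o` (odd–odd cusp). -/
inductive Par | e | o
deriving DecidableEq

/-- A candidate SCF digit `(a, ε)_s`. -/
structure Digit where
  a : ℤ
  eps : ℤ
  s : Par
deriving DecidableEq

/-- The digit set `𝒜 = {(k,ε)_s : k ≥ 2, ε = ±1, s ∈ {e,o}} ∪ {(1,+1)_e}`. -/
def Digit.Valid (d : Digit) : Prop :=
  (2 ≤ d.a ∧ (d.eps = 1 ∨ d.eps = -1)) ∨ (d.a = 1 ∧ d.eps = 1 ∧ d.s = Par.e)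

/-- The branch intervals `I_{(a,ε)_s}` of the SCF map. -/
noncomputable def branch (d : Digit) : Set ℝ :=
  match d.s with
  | Par.e =>
      if d.a = 1 then Set.Icc (1/3 : ℝ) (1/2)
      else if d.eps = 1 then Set.Ico (1 / (2 * (d.a : ℝ) + 1)) (1 / (2 * (d.a : ℝ)))
      else Set.Ico (1 / (2 * (d.a : ℝ))) (1 / (2 * (d.a : ℝ) - 1))
  | Par.o =>
      if d.eps = 1 then
        Set.Ioc ((2 * (d.a : ℝ) - 1) / (2 * (d.a : ℝ) + 1)) ((d.a : ℝ) / ((d.a : ℝ) + 1))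
      else
        Set.Ioc (((d.a : ℝ) - 1) / (d.a : ℝ)) ((2 * (d.a : ℝ) - 1) / (2 * (d.a : ℝ) + 1))

open Classical in
/-- The SCF digit of a point `y` (the unique valid digit `d` with `y ∈ I_d`;
well defined for every `y ∈ (0,1)`). -/
noncomputable def digit (y : ℝ) : Digit :=
  if h : ∃ d : Digit, d.Valid ∧ y ∈ branch d then h.choose else ⟨1, 1, Par.e⟩

/-- The `n`-th SCF digit `(a_n(x), ε_n(x))_{s_n(x)}` of `x`, `n ≥ 1`,
determined by `T^[n−1] x ∈ I_{(a_n,ε_n)_{s_n}}`. -/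
noncomputable def dig (n : ℕ) (x : ℝ) : Digit := digit (T^[n - 1] x)

/-- The `n`-th SCF partial quotient `a_n(x)`. -/
noncomputable def a (n : ℕ) (x : ℝ) : ℤ := (dig n x).a

/-- The invariant density `f_μ`. -/
noncomputable def fdens (x : ℝ) : ℝ :=
  2 / (Real.log (2 + Real.sqrt 3) * (1 - (2 - Real.sqrt 3) * x) * (1 + Real.sqrt 3 * x))

/-- The absolutely continuous `T`-invariant probability measure `μ` on `(0,1)`. -/
noncomputable def mu : Measure ℝ :=
  (volume.restrict (Set.Ioo (0 : ℝ) 1)).withDensity fun x => ENNReal.ofReal (fdens x)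

/-- The inverse branches `h_{(a,ε)_s}` of the SCF map `T`. -/
noncomputable def h (d : Digit) (x : ℝ) : ℝ :=
  match d.s with
  | Par.e => 1 / (2 * (d.a : ℝ) + (d.eps : ℝ) * x)
  | Par.o =>
      if d.eps = 1 then (((d.a : ℝ) - 1) * x + (d.a : ℝ)) / ((d.a : ℝ) * x + ((d.a : ℝ) + 1))
      else ((d.a : ℝ) * x + ((d.a : ℝ) - 1)) / (((d.a : ℝ) + 1) * x + (d.a : ℝ))

/-- Composed inverse branch `h_{A^{(n)}} = h_{A₁} ∘ ⋯ ∘ h_{A_n}` of a word. -/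
noncomputable def hWord (l : List Digit) : ℝ → ℝ :=
  l.foldr (fun d g => h d ∘ g) id

/-- The dual inverse branches `bar h_{(b,η)_t}`. -/
noncomputable def hbar (d : Digit) (y : ℝ) : ℝ :=
  match d.s with
  | Par.e => (d.eps : ℝ) / (2 * (d.a : ℝ) + y)
  | Par.o =>
      1 / (1 + (d.eps : ℝ) / (((d.a : ℝ) - ((max 0 d.eps : ℤ) : ℝ)) + 1 / (1 + y)))

/-- The matrix `M_{(a,ε)_s}` associated with the inverse branch `h_{(a,ε)_s}`. -/
noncomputable def Mdig (d : Digit) : Matrix (Fin 2) (Fin 2) ℝ :=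
  match d.s with
  | Par.e => !![0, 1; (d.eps : ℝ), 2 * (d.a : ℝ)]
  | Par.o =>
      !![(d.a : ℝ) - ((max 0 d.eps : ℤ) : ℝ), (d.a : ℝ) - ((max 0 d.eps : ℤ) : ℝ) + (d.eps : ℝ);
         (d.a : ℝ) - ((max 0 d.eps : ℤ) : ℝ) + 1, (d.a : ℝ) - ((max 0 d.eps : ℤ) : ℝ) + (d.eps : ℝ) + 1]

/-- `M_n(x) = M_{(a₁,ε₁)_{s₁}} ⋯ M_{(a_n,ε_n)_{s_n}}`. -/
noncomputable def Mn (n : ℕ) (x : ℝ) : Matrix (Fin 2) (Fin 2) ℝ :=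
  ((List.range n).map fun i => Mdig (digit (T^[i] x))).prod

/-- `P_n(x)`: the `(1,2)`-entry of `M_n(x)` (numerator of the `n`-th convergent). -/
noncomputable def Pc (n : ℕ) (x : ℝ) : ℝ := Mn n x 0 1

/-- `Q_n(x)`: the `(2,2)`-entry of `M_n(x)` (denominator of the `n`-th convergent). -/
noncomputable def Qc (n : ℕ) (x : ℝ) : ℝ := Mn n x 1 1



/-! ### Index set for the inverse branches -/

abbrev Ix := (Bool × Bool) × ℕ

def kk : Ix → ℕ
  | ((false, false), j) => j + 1
  | ((_, _), j) => j + 2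

noncomputable def al : Ix → ℝ
  | ((false, _), _) => 0
  | ((true, false), j) => (j : ℝ) + 1
  | ((true, true), j) => (j : ℝ) + 2

noncomputable def be : Ix → ℝ
  | ((false, _), _) => 1
  | ((true, false), j) => (j : ℝ) + 2
  | ((true, true), j) => (j : ℝ) + 1

noncomputable def ga : Ix → ℝ
  | ((false, false), _) => 1
  | ((false, true), _) => -1
  | ((true, false), j) => (j : ℝ) + 2
  | ((true, true), j) => (j : ℝ) + 3

noncomputable def de : Ix → ℝ
  | ((false, false), j) => 2 * (j : ℝ) + 2
  | ((false, true), j) => 2 * (j : ℝ) + 4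
  | ((true, false), j) => (j : ℝ) + 3
  | ((true, true), j) => (j : ℝ) + 2

noncomputable def hh (i : Ix) (x : ℝ) : ℝ := (al i * x + be i) / (ga i * x + de i)

lemma den_ge (i : Ix) {x : ℝ} (h0 : 0 ≤ x) (h1 : x ≤ 1) : 2 ≤ ga i * x + de i := by
  obtain ⟨⟨s, e⟩, j⟩ := i
  have hj : (0 : ℝ) ≤ j := Nat.cast_nonneg j
  have hjx : (0 : ℝ) ≤ j * x := mul_nonneg hj h0
  cases s <;> cases e <;> simp only [ga, de] <;> nlinarith

lemma num_pos (i : Ix) {x : ℝ} (h0 : 0 ≤ x) : 0 < al i * x + be i := by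
  obtain ⟨⟨s, e⟩, j⟩ := i
  have hj : (0 : ℝ) ≤ j := Nat.cast_nonneg j
  have hjx : (0 : ℝ) ≤ j * x := mul_nonneg hj h0
  cases s <;> cases e <;> simp only [al, be] <;> nlinarith

lemma num_lt (i : Ix) {x : ℝ} (h0 : 0 ≤ x) (h1 : x ≤ 1) :
    al i * x + be i < ga i * x + de i := by
  obtain ⟨⟨s, e⟩, j⟩ := i
  have hj : (0 : ℝ) ≤ j := Nat.cast_nonneg j
  have hjx : (0 : ℝ) ≤ j * x := mul_nonneg hj h0
  cases s <;> cases e <;> simp only [al, be, ga, de] <;> nlinarith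

lemma det_sq (i : Ix) : |al i * de i - be i * ga i| = 1 := by
  obtain ⟨⟨s, e⟩, j⟩ := i
  cases s <;> cases e <;> simp only [al, be, ga, de]
  · norm_num
  · norm_num
  · rw [show ((j : ℝ) + 1) * (j + 3) - (j + 2) * (j + 2) = -1 by ring]; norm_num
  · rw [show ((j : ℝ) + 2) * (j + 2) - (j + 1) * (j + 3) = 1 by ring]; norm_num

lemma hh_mem (i : Ix) {x : ℝ} (hx : x ∈ Ioo (0 : ℝ) 1) : hh i x ∈ Ioo (0 : ℝ) 1 := by
  have h1 := den_ge i hx.1.le hx.2.le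
  have h2 := num_pos i hx.1.le
  have h3 := num_lt i hx.1.le hx.2.le
  unfold hh
  exact ⟨by positivity, by rw [div_lt_one (by linarith)]; exact h3⟩

lemma hh_contr (i : Ix) {x y : ℝ} (hx : x ∈ Ioo (0 : ℝ) 1) (hy : y ∈ Ioo (0 : ℝ) 1) :
    |hh i x - hh i y| ≤ |x - y| / 4 := by
  have h1 := den_ge i hx.1.le hx.2.le
  have h2 := den_ge i hy.1.le hy.2.le
  have e : hh i x - hh i y = (al i * de i - be i * ga i) * (x - y) /
      ((ga i * x + de i) * (ga i * y + de i)) := by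
    unfold hh
    rw [div_sub_div _ _ (by linarith) (by linarith)]
    congr 1
    ring
  rw [e, abs_div, abs_mul, det_sq, one_mul]
  apply div_le_div_of_nonneg_left (abs_nonneg _) (by norm_num)
  refine le_trans ?_ (le_abs_self _)
  nlinarith

lemma hh_deriv (i : Ix) {x : ℝ} (hx : x ∈ Ioo (0 : ℝ) 1) :
    HasDerivAt (hh i) ((al i * de i - be i * ga i) / (ga i * x + de i) ^ 2) x := by
  have h1 := den_ge i hx.1.le hx.2.le
  have hn : HasDerivAt (fun x => al i * x + be i) (al i) x := by
    simpa using ((hasDerivAt_id x).const_mul (al i)).add_const (be i)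
  have hd : HasDerivAt (fun x => ga i * x + de i) (ga i) x := by
    simpa using ((hasDerivAt_id x).const_mul (ga i)).add_const (de i)
  have := hn.div hd (by linarith)
  refine HasDerivAt.congr_deriv (f := hh i) this ?_
  congr 1
  ring

lemma hh_meas (i : Ix) : Measurable (hh i) := by
  unfold hh
  fun_prop

lemma iota_iota {x : ℝ} (h0 : 0 < x) : iota (iota x) = x := by
  unfold iota
  have : 1 + x ≠ 0 := by linarith
  field_simp
  ring

lemma iota_mem {x : ℝ} (hx : x ∈ Ioo (0 : ℝ) 1) : iota x ∈ Ioo (0 : ℝ) 1 := by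
  unfold iota
  obtain ⟨h0, h1⟩ := hx
  exact ⟨div_pos (by linarith) (by linarith), by rw [div_lt_one (by linarith)]; linarith⟩

/-- even branch values -/
lemma hh_e0 (j : ℕ) (x : ℝ) : hh ((false, false), j) x = 1 / (2 * ((j : ℝ) + 1) + x) := by
  simp only [hh, al, be, ga, de]; congr 1 <;> ring

lemma hh_e1 (j : ℕ) (x : ℝ) : hh ((false, true), j) x = 1 / (2 * ((j : ℝ) + 2) - x) := by
  simp only [hh, al, be, ga, de]; congr 1 <;> ring

lemma iota_div {n d : ℝ} (hd : d ≠ 0) : iota (n / d) = (d - n) / (d + n) := by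
  unfold iota
  rw [one_sub_div hd, one_add_div hd, div_div_div_cancel_right₀ hd]

lemma iota_o0 (j : ℕ) {x : ℝ} (hx : x ∈ Ioo (0 : ℝ) 1) :
    iota (hh ((true, false), j) x) = 1 / (2 * ((j : ℝ) + 2) + iota x) := by
  have hj : (0 : ℝ) ≤ j := Nat.cast_nonneg j
  have h1 := den_ge ((true, false), j) hx.1.le hx.2.le
  have h3 := num_pos ((true, false), j) hx.1.le
  have h2 := (iota_mem hx).1
  simp only [ga, de, al, be] at h1 h3
  have h4 : 1 + x ≠ 0 := by linarith [hx.1]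
  have h7 : (((j : ℝ) + 2) * x + (j + 3)) ≠ 0 := by linarith
  simp only [hh, al, be, ga, de]
  rw [iota_div h7, iota]
  have h8 : 2 * ((j : ℝ) + 2) + (1 - x) / (1 + x) =
      (2 * ((j : ℝ) + 2) * (1 + x) + (1 - x)) / (1 + x) := by
    field_simp
  rw [h8, one_div_div]
  congr 1 <;> ring

lemma iota_o1 (j : ℕ) {x : ℝ} (hx : x ∈ Ioo (0 : ℝ) 1) :
    iota (hh ((true, true), j) x) = 1 / (2 * ((j : ℝ) + 2) - iota x) := by
  have hj : (0 : ℝ) ≤ j := Nat.cast_nonneg j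
  have h1 := den_ge ((true, true), j) hx.1.le hx.2.le
  have h3 := num_pos ((true, true), j) hx.1.le
  have h2 := (iota_mem hx).2
  simp only [ga, de, al, be] at h1 h3
  have h4 : 1 + x ≠ 0 := by linarith [hx.1]
  have h7 : (((j : ℝ) + 3) * x + (j + 2)) ≠ 0 := by linarith
  simp only [hh, al, be, ga, de]
  rw [iota_div h7, iota]
  have h8 : 2 * ((j : ℝ) + 2) - (1 - x) / (1 + x) =
      (2 * ((j : ℝ) + 2) * (1 + x) - (1 - x)) / (1 + x) := by
    field_simp
  rw [h8, one_div_div]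
  congr 1 <;> ring

lemma hh_e_lt (e : Bool) (j : ℕ) {x : ℝ} (hx : x ∈ Ioo (0 : ℝ) 1) :
    hh ((false, e), j) x < 1 / 2 := by
  have hj : (0 : ℝ) ≤ j := Nat.cast_nonneg j
  obtain ⟨h0, h1⟩ := hx
  cases e
  · rw [hh_e0]; apply one_div_lt_one_div_of_lt <;> linarith
  · rw [hh_e1]; apply one_div_lt_one_div_of_lt <;> linarith

lemma hh_o_gt (e : Bool) (j : ℕ) {x : ℝ} (hx : x ∈ Ioo (0 : ℝ) 1) :
    1 / 2 < hh ((true, e), j) x := by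
  have hj : (0 : ℝ) ≤ j := Nat.cast_nonneg j
  have h1 := den_ge ((true, e), j) hx.1.le hx.2.le
  obtain ⟨h0, h2⟩ := hx
  unfold hh
  rw [div_lt_div_iff₀ (by norm_num) (by linarith)]
  have hjx : (0 : ℝ) ≤ j * x := mul_nonneg hj h0.le
  cases e <;> simp only [al, be, ga, de] at * <;> nlinarith

/-- common parameter: `N` with `1/y` or `1/ι y` in `(N, N+1)`. -/
def NN : Ix → ℤ
  | ((false, false), j) => 2 * j + 2
  | ((false, true), j) => 2 * j + 3
  | ((true, false), j) => 2 * j + 4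
  | ((true, true), j) => 2 * j + 3

lemma NN_e (e : Bool) (j : ℕ) {x : ℝ} (hx : x ∈ Ioo (0 : ℝ) 1) :
    1 / hh ((false, e), j) x ∈ Ioo (NN ((false, e), j) : ℝ) (NN ((false, e), j) + 1) := by
  obtain ⟨h0, h1⟩ := hx
  cases e
  · rw [hh_e0, one_div_one_div]; simp only [NN]; push_cast; constructor <;> linarith
  · rw [hh_e1, one_div_one_div]; simp only [NN]; push_cast; constructor <;> linarith

lemma NN_o (e : Bool) (j : ℕ) {x : ℝ} (hx : x ∈ Ioo (0 : ℝ) 1) :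
    1 / iota (hh ((true, e), j) x) ∈ Ioo (NN ((true, e), j) : ℝ) (NN ((true, e), j) + 1) := by
  obtain ⟨h0, h1⟩ := iota_mem hx
  cases e
  · rw [iota_o0 j hx, one_div_one_div]; simp only [NN]; push_cast; constructor <;> linarith
  · rw [iota_o1 j hx, one_div_one_div]; simp only [NN]; push_cast; constructor <;> linarith

lemma hh_inj {i i' : Ix} {x x' : ℝ} (hx : x ∈ Ioo (0 : ℝ) 1) (hx' : x' ∈ Ioo (0 : ℝ) 1)
    (h : hh i x = hh i' x') : i = i' := by
  obtain ⟨⟨s, e⟩, j⟩ := i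
  obtain ⟨⟨s', e'⟩, j'⟩ := i'
  have key : s = s' ∧ NN ((s, e), j) = NN ((s', e'), j') := by
    cases s <;> cases s'
    · have h1 := NN_e e j hx
      have h2 := NN_e e' j' hx'
      rw [h] at h1
      refine ⟨rfl, ?_⟩
      have a1 := h1.1.trans h2.2
      have a2 := h2.1.trans h1.2
      norm_cast at a1 a2
      omega
    · have h1 := hh_e_lt e j hx
      have h2 := hh_o_gt e' j' hx'
      linarith
    · have h1 := hh_e_lt e' j' hx'
      have h2 := hh_o_gt e j hx
      linarith
    · have h1 := NN_o e j hx
      have h2 := NN_o e' j' hx'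
      rw [h] at h1
      refine ⟨rfl, ?_⟩
      have a1 := h1.1.trans h2.2
      have a2 := h2.1.trans h1.2
      norm_cast at a1 a2
      omega
  obtain ⟨rfl, h2⟩ := key
  cases s <;> cases e <;> cases e' <;> simp only [NN] at h2 <;>
    first
    | (exfalso; omega)
    | (have : j = j' := by omega
       rw [this])

lemma Te_add (n : ℕ) {t : ℝ} (ht : t ∈ Ioo (0 : ℝ) 1) : Te (1 / (2 * (n : ℝ) + t)) = t := by
  unfold Te
  rw [one_div_one_div]
  have : ⌊(2 * (n : ℝ) + t + 1) / 2⌋ = (n : ℤ) := by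
    rw [Int.floor_eq_iff]; push_cast; constructor <;> linarith [ht.1, ht.2]
  rw [this]; push_cast
  rw [add_sub_cancel_left, abs_of_pos ht.1]

lemma Te_sub (n : ℕ) {t : ℝ} (ht : t ∈ Ioo (0 : ℝ) 1) : Te (1 / (2 * (n : ℝ) - t)) = t := by
  unfold Te
  rw [one_div_one_div]
  have : ⌊(2 * (n : ℝ) - t + 1) / 2⌋ = (n : ℤ) := by
    rw [Int.floor_eq_iff]; push_cast; constructor <;> linarith [ht.1, ht.2]
  rw [this]; push_cast
  rw [sub_sub_cancel_left, abs_neg, abs_of_pos ht.1]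

lemma T_hh (i : Ix) {x : ℝ} (hx : x ∈ Ioo (0 : ℝ) 1) : T (hh i x) = x := by
  have hm := hh_mem i hx
  unfold T
  rw [if_neg (not_le.2 hm.1), if_neg (not_le.2 hm.2)]
  obtain ⟨⟨s, e⟩, j⟩ := i
  cases s
  · rw [if_pos (hh_e_lt e j hx).le]
    cases e
    · rw [hh_e0]
      simpa using Te_add (j + 1) hx
    · rw [hh_e1]
      simpa using Te_sub (j + 2) hx
  · rw [if_neg (not_le.2 (hh_o_gt e j hx))]
    have hi := iota_mem hx
    cases e
    · rw [iota_o0 j hx]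
      have := Te_add (j + 2) hi
      push_cast at this
      rw [this, iota_iota hx.1]
    · rw [iota_o1 j hx]
      have := Te_sub (j + 2) hi
      push_cast at this
      rw [this, iota_iota hx.1]

lemma iota_inj {x y : ℝ} (hx : 0 < x) (hy : 0 < y) (h : iota x = iota y) : x = y := by
  rw [← iota_iota hx, ← iota_iota hy, h]

lemma irr_frac {z : ℝ} (hz : Irrational z) : 0 < Int.fract z ∧ Int.fract z < 1 := by
  refine ⟨lt_of_le_of_ne (Int.fract_nonneg z) ?_, Int.fract_lt_one z⟩
  intro h0
  have : z = (⌊z⌋ : ℝ) := by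
    have := Int.floor_add_fract z
    rw [← h0] at this
    linarith
  exact hz.ne_int _ this

/-- every irrational `z > 2` is `2n + t` or `2n+2 - t` -/
lemma decomp {z : ℝ} (hz : Irrational z) (h2 : 2 < z) :
    (∃ n : ℕ, ∃ t ∈ Ioo (0 : ℝ) 1, z = 2 * ((n : ℝ) + 1) + t) ∨
    (∃ n : ℕ, ∃ t ∈ Ioo (0 : ℝ) 1, z = 2 * ((n : ℝ) + 2) - t) := by
  have hf := irr_frac hz
  have hfl := Int.floor_add_fract z
  have h2f : 2 ≤ ⌊z⌋ := Int.le_floor.2 (by exact_mod_cast h2.le)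
  rcases Int.even_or_odd' ⌊z⌋ with ⟨m, hm | hm⟩
  · left
    refine ⟨(m - 1).toNat, Int.fract z, hf, ?_⟩
    have : (((m - 1).toNat : ℤ) : ℝ) = ((m - 1 : ℤ) : ℝ) := by
      rw [Int.toNat_of_nonneg (by omega)]
    push_cast at this
    rw [this]
    have h3 : (⌊z⌋ : ℝ) = 2 * m := by rw [hm]; push_cast; ring
    linarith
  · right
    refine ⟨(m - 1).toNat, 1 - Int.fract z, ⟨by linarith, by linarith⟩, ?_⟩
    have : (((m - 1).toNat : ℤ) : ℝ) = ((m - 1 : ℤ) : ℝ) := by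
      rw [Int.toNat_of_nonneg (by omega)]
    push_cast at this
    rw [this]
    have h3 : (⌊z⌋ : ℝ) = 2 * m + 1 := by rw [hm]; push_cast; ring
    linarith

lemma exists_hh {y : ℝ} (hy : y ∈ Ioo (0 : ℝ) 1) (hirr : Irrational y) :
    ∃ i : Ix, ∃ x ∈ Ioo (0 : ℝ) 1, hh i x = y := by
  have hne : y ≠ 1 / 2 := by
    intro h
    exact hirr ⟨1 / 2, by rw [h]; norm_num⟩
  rcases lt_or_gt_of_ne hne with h | h
  · have hz : Irrational (1 / y) := by simpa using hirr
    have h2 : 2 < 1 / y := by rw [lt_div_iff₀ hy.1]; linarith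
    rcases decomp hz h2 with ⟨n, t, ht, e⟩ | ⟨n, t, ht, e⟩
    · exact ⟨((false, false), n), t, ht, by rw [hh_e0, ← e, one_div_one_div]⟩
    · exact ⟨((false, true), n), t, ht, by rw [hh_e1, ← e, one_div_one_div]⟩
  · have hi := iota_mem hy
    have hz0 : Irrational (iota y) := by
      rintro ⟨q, hq⟩
      apply hirr
      refine ⟨(1 - q) / (1 + q), ?_⟩
      rw [← iota_iota hy.1, ← hq]
      simp [iota]
    have hz : Irrational (1 / iota y) := by simpa using hz0
    have h2 : 3 < 1 / iota y := by
      rw [lt_div_iff₀ hi.1]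
      unfold iota
      rw [← mul_div_assoc, div_lt_one (by linarith)]
      linarith
    rcases decomp hz (by linarith) with ⟨n, t, ht, e⟩ | ⟨n, t, ht, e⟩
    · obtain _ | n := n
      · push_cast at e
        linarith [ht.2]
      · refine ⟨((true, false), n), iota t, iota_mem ht, ?_⟩
        refine iota_inj (hh_mem _ (iota_mem ht)).1 hy.1 ?_
        rw [iota_o0 _ (iota_mem ht), iota_iota ht.1, ← one_div_one_div (iota y), e]
        push_cast
        congr 1
        ring
    · refine ⟨((true, true), n), iota t, iota_mem ht, ?_⟩
      refine iota_inj (hh_mem _ (iota_mem ht)).1 hy.1 ?_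
      rw [iota_o1 _ (iota_mem ht), iota_iota ht.1, ← one_div_one_div (iota y), e]

/-- the digit attached to an index -/
def dg : Ix → Digit
  | ((false, false), j) => ⟨(j : ℤ) + 1, 1, Par.e⟩
  | ((false, true), j) => ⟨(j : ℤ) + 2, -1, Par.e⟩
  | ((true, false), j) => ⟨(j : ℤ) + 2, 1, Par.o⟩
  | ((true, true), j) => ⟨(j : ℤ) + 2, -1, Par.o⟩

lemma dg_valid (i : Ix) : (dg i).Valid := by
  obtain ⟨⟨s, e⟩, j⟩ := i
  cases s <;> cases e <;> simp only [dg, Digit.Valid] <;> simp <;> omega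

lemma mem_branch_dg (i : Ix) {x : ℝ} (hx : x ∈ Ioo (0 : ℝ) 1) : hh i x ∈ branch (dg i) := by
  obtain ⟨⟨s, e⟩, j⟩ := i
  have hj : (0 : ℝ) ≤ j := Nat.cast_nonneg j
  have hd := den_ge ((s, e), j) hx.1.le hx.2.le
  obtain ⟨h0, h1⟩ := hx
  have hjx : (0 : ℝ) ≤ j * x := mul_nonneg hj h0.le
  have hjx' : (0 : ℝ) ≤ j * (1 - x) := mul_nonneg hj (by linarith)
  cases s <;> cases e
  · rw [show dg ((false, false), j) = ⟨(j : ℤ) + 1, 1, Par.e⟩ from rfl]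
    simp only [branch]
    rw [hh_e0]
    split_ifs with hc
    · have : (j : ℝ) = 0 := by
        have : (j : ℤ) = 0 := by linarith
        exact_mod_cast this
      rw [this]
      constructor
      · apply one_div_le_one_div_of_le <;> linarith
      · apply one_div_le_one_div_of_le <;> linarith
    · push_cast
      constructor
      · apply one_div_le_one_div_of_le <;> linarith
      · apply one_div_lt_one_div_of_lt <;> linarith
  · rw [show dg ((false, true), j) = ⟨(j : ℤ) + 2, -1, Par.e⟩ from rfl]
    simp only [branch]
    rw [hh_e1, if_neg (by omega), if_neg (by norm_num)]
    push_cast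
    constructor
    · apply one_div_le_one_div_of_le <;> linarith
    · apply one_div_lt_one_div_of_lt <;> linarith
  · rw [show dg ((true, false), j) = ⟨(j : ℤ) + 2, 1, Par.o⟩ from rfl]
    simp only [branch, if_true, hh, al, be, ga, de] at hd ⊢
    push_cast
    constructor
    · rw [div_lt_div_iff₀ (by linarith) (by linarith)]; nlinarith
    · rw [div_le_div_iff₀ (by linarith) (by linarith)]; nlinarith
  · rw [show dg ((true, true), j) = ⟨(j : ℤ) + 2, -1, Par.o⟩ from rfl]
    simp only [branch, hh, al, be, ga, de] at hd ⊢
    rw [if_neg (by norm_num)]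
    push_cast
    constructor
    · rw [div_lt_div_iff₀ (by linarith) (by linarith)]; nlinarith
    · rw [div_le_div_iff₀ (by linarith) (by linarith)]; nlinarith

/-- description of a valid branch by `1/y` or `1/ι y` -/
lemma branch_desc {d : Digit} (hd : d.Valid) {y : ℝ} (hy : y ∈ Ioo (0 : ℝ) 1)
    (hb : y ∈ branch d) :
    (y ≤ 1 / 2 ∧ 2 * (d.a : ℝ) - 1 < 1 / y ∧ 1 / y ≤ 2 * (d.a : ℝ) + 1) ∨
    (1 / 2 < y ∧ 2 * (d.a : ℝ) - 1 ≤ 1 / iota y ∧ 1 / iota y ≤ 2 * (d.a : ℝ) + 1) := by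
  obtain ⟨k, ε, s⟩ := d
  obtain ⟨hy0, hy1⟩ := hy
  have hk1 : (1 : ℝ) ≤ k := by
    have : (1 : ℤ) ≤ k := by
      rcases hd with h | h
      · have := h.1; simp only at this; omega
      · have := h.1; simp only at this; omega
    exact_mod_cast this
  cases s
  · left
    simp only [branch] at hb ⊢
    split_ifs at hb with c1 c2
    · subst c1
      push_cast
      refine ⟨hb.2, ?_, ?_⟩
      · rw [lt_div_iff₀ hy0]; linarith
      · rw [div_le_iff₀ hy0]; linarith [hb.1]
    · obtain ⟨b1, b2⟩ := hb
      rw [div_le_iff₀ (by linarith)] at b1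
      rw [lt_div_iff₀ (by linarith)] at b2
      refine ⟨by nlinarith, ?_, ?_⟩
      · rw [lt_div_iff₀ hy0]; nlinarith
      · rw [div_le_iff₀ hy0]; nlinarith
    · obtain ⟨b1, b2⟩ := hb
      have hk2 : (2 : ℝ) ≤ k := by
        have : (2 : ℤ) ≤ k := by
          rcases hd with h | h
          · exact h.1
          · exact absurd h.1 c1
        exact_mod_cast this
      rw [div_le_iff₀ (by linarith)] at b1
      rw [lt_div_iff₀ (by linarith)] at b2
      refine ⟨by nlinarith, ?_, ?_⟩
      · rw [lt_div_iff₀ hy0]; nlinarith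
      · rw [div_le_iff₀ hy0]; nlinarith
  · right
    have hk2 : (2 : ℝ) ≤ k := by
      have : (2 : ℤ) ≤ k := by
        rcases hd with h | h
        · exact h.1
        · have := h.2.2
          simp at this
      exact_mod_cast this
    simp only [branch] at hb ⊢
    unfold iota
    rw [one_div_div]
    split_ifs at hb with c1
    · obtain ⟨b1, b2⟩ := hb
      rw [div_lt_iff₀ (by linarith)] at b1
      rw [le_div_iff₀ (by linarith)] at b2
      refine ⟨by nlinarith, ?_, ?_⟩
      · rw [le_div_iff₀ (by linarith)]; nlinarith
      · rw [div_le_iff₀ (by linarith)]; nlinarith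
    · obtain ⟨b1, b2⟩ := hb
      rw [div_lt_iff₀ (by linarith)] at b1
      rw [le_div_iff₀ (by linarith)] at b2
      refine ⟨by nlinarith, ?_, ?_⟩
      · rw [le_div_iff₀ (by linarith)]; nlinarith
      · rw [div_le_iff₀ (by linarith)]; nlinarith

lemma digit_hh (i : Ix) {x : ℝ} (hx : x ∈ Ioo (0 : ℝ) 1) : (digit (hh i x)).a = kk i := by
  have hex : ∃ d : Digit, d.Valid ∧ hh i x ∈ branch d := ⟨dg i, dg_valid i, mem_branch_dg i hx⟩
  have hdig : digit (hh i x) = hex.choose := by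
    unfold digit
    rw [dif_pos hex]
  obtain ⟨h1, h2⟩ := hex.choose_spec
  rw [hdig]
  generalize hex.choose = d at h1 h2
  have hdesc := branch_desc h1 (hh_mem i hx) h2
  obtain ⟨⟨s, e⟩, j⟩ := i
  have key : 2 * d.a - 1 < NN ((s, e), j) + 1 ∧ NN ((s, e), j) < 2 * d.a + 1 := by
    cases s
    · have h3 := NN_e e j hx
      have h4 := hh_e_lt e j hx
      rcases hdesc with h | h
      · have a1 := h.2.1.trans h3.2
        have a2 := h3.1.trans_le h.2.2
        exact ⟨by exact_mod_cast a1, by exact_mod_cast a2⟩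
      · linarith [h.1]
    · have h3 := NN_o e j hx
      have h4 := hh_o_gt e j hx
      rcases hdesc with h | h
      · linarith [h.1]
      · have a1 := h.2.1.trans_lt h3.2
        have a2 := h3.1.trans_le h.2.2
        exact ⟨by exact_mod_cast a1, by exact_mod_cast a2⟩
  cases s <;> cases e <;> simp only [NN, kk] at key ⊢ <;> push_cast <;> omega

/-! ### Weights -/

lemma s3_sq : √(3 : ℝ) * √3 = 3 := Real.mul_self_sqrt (by norm_num)
lemma s3_gt : (1.7 : ℝ) < √3 := by rw [Real.lt_sqrt (by norm_num)]; norm_num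
lemma s3_lt : √(3 : ℝ) < 1.8 := by rw [Real.sqrt_lt' (by norm_num)]; norm_num

lemma s3_prop : ∃ b : ℝ, √3 = b ∧ b * b = 3 ∧ 1.7 < b ∧ b < 1.8 :=
  ⟨√3, rfl, s3_sq, s3_gt, s3_lt⟩

noncomputable def den1 (i : Ix) (x : ℝ) : ℝ :=
  (ga i * x + de i) - (2 - √3) * (al i * x + be i)
noncomputable def den2 (i : Ix) (x : ℝ) : ℝ :=
  (ga i * x + de i) + √3 * (al i * x + be i)
noncomputable def W (i : Ix) (x : ℝ) : ℝ := 2 / (den1 i x * den2 i x)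
noncomputable def r1 (x : ℝ) : ℝ := 1 - (2 - √3) * x
noncomputable def r2 (x : ℝ) : ℝ := 1 + √3 * x
noncomputable def wt (i : Ix) (x : ℝ) : ℝ := (r1 x * r2 x) / (den1 i x * den2 i x)

lemma r1_pos {x : ℝ} (hx : x ∈ Ioo (0 : ℝ) 1) : 0 < r1 x := by
  have := s3_gt; have := s3_lt; obtain ⟨h0, h1⟩ := hx; unfold r1; nlinarith

lemma r2_pos {x : ℝ} (hx : x ∈ Ioo (0 : ℝ) 1) : 0 < r2 x := by
  have := s3_gt; obtain ⟨h0, h1⟩ := hx; unfold r2; positivity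

lemma den1_pos (i : Ix) {x : ℝ} (hx : x ∈ Ioo (0 : ℝ) 1) : 0 < den1 i x := by
  have := s3_gt; have := s3_lt
  have h1 := den_ge i hx.1.le hx.2.le
  have h2 := num_pos i hx.1.le
  have h3 := num_lt i hx.1.le hx.2.le
  unfold den1
  nlinarith

lemma den2_pos (i : Ix) {x : ℝ} (hx : x ∈ Ioo (0 : ℝ) 1) : 0 < den2 i x := by
  have := s3_gt
  have h1 := den_ge i hx.1.le hx.2.le
  have h2 := num_pos i hx.1.le
  unfold den2
  positivity

lemma wt_pos (i : Ix) {x : ℝ} (hx : x ∈ Ioo (0 : ℝ) 1) : 0 < wt i x :=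
  div_pos (mul_pos (r1_pos hx) (r2_pos hx)) (mul_pos (den1_pos i hx) (den2_pos i hx))

lemma lin_dist {A B x y : ℝ} (hB : |B| ≤ 2 * (A + B * y)) :
    A + B * x ≤ Real.exp (2 * |x - y|) * (A + B * y) := by
  have h0 : 0 ≤ A + B * y := by linarith [abs_nonneg B]
  have h1 : B * (x - y) ≤ 2 * (A + B * y) * |x - y| := by
    calc B * (x - y) ≤ |B * (x - y)| := le_abs_self _
      _ = |B| * |x - y| := abs_mul _ _
      _ ≤ _ := mul_le_mul_of_nonneg_right hB (abs_nonneg _)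
  have h2 := Real.add_one_le_exp (2 * |x - y|)
  nlinarith [mul_le_mul_of_nonneg_right h2 h0]

lemma r1_dist {x y : ℝ} (hy : y ∈ Ioo (0 : ℝ) 1) :
    r1 x ≤ Real.exp (2 * |x - y|) * r1 y := by
  have := s3_gt; have := s3_lt; obtain ⟨h0, h1⟩ := hy
  have := @lin_dist 1 (-(2 - √3)) x y (by rw [abs_neg, abs_of_pos (by linarith)]; nlinarith)
  unfold r1
  convert this using 1 <;> ring

lemma r2_dist {x y : ℝ} (hy : y ∈ Ioo (0 : ℝ) 1) :
    r2 x ≤ Real.exp (2 * |x - y|) * r2 y := by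
  have := s3_gt; have := s3_lt; obtain ⟨h0, h1⟩ := hy
  exact @lin_dist 1 (√3) x y (by rw [abs_of_pos (by linarith)]; nlinarith)

lemma den1_dist (i : Ix) {x y : ℝ} (hy : y ∈ Ioo (0 : ℝ) 1) :
    den1 i x ≤ Real.exp (2 * |x - y|) * den1 i y := by
  have h := @lin_dist (de i - (2 - √3) * be i) (ga i - (2 - √3) * al i) x y ?_
  · unfold den1
    convert h using 1 <;> ring
  · obtain ⟨b, hb, hb2, hb3, hb4⟩ := s3_prop
    rw [hb]
    obtain ⟨h0, h1⟩ := hy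
    obtain ⟨⟨s, e⟩, j⟩ := i
    have hj : (0 : ℝ) ≤ j := Nat.cast_nonneg j
    have hbj : 1.7 * (j : ℝ) ≤ b * j := mul_le_mul_of_nonneg_right hb3.le hj
    have hbj2 : b * (j : ℝ) ≤ 1.8 * j := mul_le_mul_of_nonneg_right hb4.le hj
    cases s <;> cases e <;> simp only [al, be, ga, de] <;> rw [abs_le]
    · constructor <;> nlinarith
    · constructor <;> nlinarith
    · have hc : (0 : ℝ) ≤ ((j : ℝ) + 2 - (2 - b) * (j + 1)) := by nlinarith
      have := mul_nonneg hc h0.le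
      constructor <;> nlinarith
    · have hc : (0 : ℝ) ≤ ((j : ℝ) + 3 - (2 - b) * (j + 2)) := by nlinarith
      have := mul_nonneg hc h0.le
      constructor <;> nlinarith

lemma den2_dist (i : Ix) {x y : ℝ} (hy : y ∈ Ioo (0 : ℝ) 1) :
    den2 i x ≤ Real.exp (2 * |x - y|) * den2 i y := by
  have h := @lin_dist (de i + √3 * be i) (ga i + √3 * al i) x y ?_
  · unfold den2
    convert h using 1 <;> ring
  · obtain ⟨b, hb, hb2, hb3, hb4⟩ := s3_prop
    rw [hb]
    obtain ⟨h0, h1⟩ := hy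
    obtain ⟨⟨s, e⟩, j⟩ := i
    have hj : (0 : ℝ) ≤ j := Nat.cast_nonneg j
    have hbj : 1.7 * (j : ℝ) ≤ b * j := mul_le_mul_of_nonneg_right hb3.le hj
    have hbj2 : b * (j : ℝ) ≤ 1.8 * j := mul_le_mul_of_nonneg_right hb4.le hj
    cases s <;> cases e <;> simp only [al, be, ga, de] <;> rw [abs_le]
    · constructor <;> nlinarith
    · constructor <;> nlinarith
    · have hc : (0 : ℝ) ≤ ((j : ℝ) + 2 + b * (j + 1)) := by nlinarith
      have := mul_nonneg hc h0.le
      constructor <;> nlinarith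
    · have hc : (0 : ℝ) ≤ ((j : ℝ) + 3 + b * (j + 2)) := by nlinarith
      have := mul_nonneg hc h0.le
      constructor <;> nlinarith

lemma wt_dist (i : Ix) {x y : ℝ} (hx : x ∈ Ioo (0 : ℝ) 1) (hy : y ∈ Ioo (0 : ℝ) 1) :
    wt i x ≤ Real.exp (8 * |x - y|) * wt i y := by
  have e1 := @r1_dist x y hy
  have e2 := @r2_dist x y hy
  have e3 := @den1_dist i y x hx
  have e4 := @den2_dist i y x hx
  rw [abs_sub_comm y x] at e3 e4
  have p1 := r1_pos hx
  have p2 := r2_pos hx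
  have p3 := den1_pos i hx
  have p4 := den2_pos i hx
  have q1 := r1_pos hy
  have q2 := r2_pos hy
  have q3 := den1_pos i hy
  have q4 := den2_pos i hy
  have hE : Real.exp (8 * |x - y|) = Real.exp (2 * |x - y|) * Real.exp (2 * |x - y|) *
      (Real.exp (2 * |x - y|) * Real.exp (2 * |x - y|)) := by
    rw [← Real.exp_add, ← Real.exp_add]; congr 1; ring
  have hp := Real.exp_pos (2 * |x - y|)
  rw [hE]
  generalize Real.exp (2 * |x - y|) = E at *
  unfold wt
  rw [← mul_div_assoc, div_le_div_iff₀ (by positivity) (by positivity)]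
  have hN : r1 x * r2 x ≤ (E * r1 y) * (E * r2 y) := by gcongr
  have hD : den1 i y * den2 i y ≤ (E * den1 i x) * (E * den2 i x) := by gcongr
  calc r1 x * r2 x * (den1 i y * den2 i y)
      ≤ ((E * r1 y) * (E * r2 y)) * ((E * den1 i x) * (E * den2 i x)) := by gcongr
    _ = _ := by ring

/-! ### Telescoping sum of the weights -/

lemma hasSum_tele {W v : ℕ → ℝ} {l : ℝ} (hW : ∀ j, W j = v j - v (j + 1)) (h0 : ∀ j, 0 ≤ W j)
    (hl : Tendsto v atTop (𝓝 l)) : HasSum W (v 0 - l) := by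
  rw [hasSum_iff_tendsto_nat_of_nonneg h0]
  have : (fun n => ∑ i ∈ Finset.range n, W i) = fun n => v 0 - v n := by
    ext n
    simp only [hW]
    exact Finset.sum_range_sub' v n
  rw [this]
  exact hl.const_sub _

lemma tend_inv {p q : ℝ} (hp : 0 < p) : Tendsto (fun j : ℕ => 1 / (p * (j : ℝ) + q)) atTop (𝓝 0) := by
  simp only [one_div]
  apply tendsto_inv_atTop_zero.comp
  exact tendsto_atTop_add_const_right _ _ (tendsto_natCast_atTop_atTop.const_mul_atTop hp)

lemma W_nonneg (i : Ix) {x : ℝ} (hx : x ∈ Ioo (0 : ℝ) 1) : 0 ≤ W i x := by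
  have := den1_pos i hx
  have := den2_pos i hx
  unfold W
  positivity

lemma sum_e0 {x : ℝ} (hx : x ∈ Ioo (0 : ℝ) 1) :
    HasSum (fun j : ℕ => W ((false, false), j) x) (1 / (√3 + x)) := by
  have h := @hasSum_tele (fun j : ℕ => W ((false, false), j) x)
    (fun j : ℕ => 1 / (2 * (j : ℝ) + (√3 + x))) 0 ?_ (fun j => W_nonneg _ hx)
    (tend_inv (by norm_num))
  · simpa using h
  · intro j
    have hj : (0 : ℝ) ≤ j := Nat.cast_nonneg j
    obtain ⟨h0, h1⟩ := hx
    simp only [W, den1, den2, al, be, ga, de]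
    obtain ⟨b, hb, hb2, hb3, hb4⟩ := s3_prop
    rw [hb]
    push_cast
    rw [div_sub_div _ _ (by positivity) (by positivity)]
    congr 1 <;> ring

lemma sum_e1 {x : ℝ} (hx : x ∈ Ioo (0 : ℝ) 1) :
    HasSum (fun j : ℕ => W ((false, true), j) x) (1 / (2 + √3 - x)) := by
  have h := @hasSum_tele (fun j : ℕ => W ((false, true), j) x)
    (fun j : ℕ => 1 / (2 * (j : ℝ) + (2 + √3 - x))) 0 ?_ (fun j => W_nonneg _ hx)
    (tend_inv (by norm_num))
  · simpa using h
  · intro j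
    have hj : (0 : ℝ) ≤ j := Nat.cast_nonneg j
    obtain ⟨h0, h1⟩ := hx
    simp only [W, den1, den2, al, be, ga, de]
    obtain ⟨b, hb, hb2, hb3, hb4⟩ := s3_prop
    rw [hb]
    push_cast
    rw [div_sub_div _ _ (by linarith) (by linarith)]
    congr 1 <;> ring

/-- Moebius limits: `(p j + q)/(r j + s) → p / r`. -/
lemma tend_moeb {p q r s : ℝ} (hr : 0 < r) :
    Tendsto (fun j : ℕ => (p * (j : ℝ) + q) / (r * (j : ℝ) + s)) atTop (𝓝 (p / r)) := by
  have h1 : Tendsto (fun j : ℕ => p / r + (q - p * s / r) * (1 / (r * (j : ℝ) + s))) atTop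
      (𝓝 (p / r + (q - p * s / r) * 0)) := (tend_inv hr).const_mul _ |>.const_add _
  rw [mul_zero, add_zero] at h1
  refine h1.congr' ?_
  have h2 : Tendsto (fun j : ℕ => r * (j : ℝ) + s) atTop atTop :=
    tendsto_atTop_add_const_right _ _ (tendsto_natCast_atTop_atTop.const_mul_atTop hr)
  filter_upwards [h2.eventually_gt_atTop 0] with j hj
  have hj' : r * (j : ℝ) + s ≠ 0 := hj.ne'
  rw [mul_one_div, div_add_div _ _ hr.ne' hj', div_eq_div_iff (mul_ne_zero hr.ne' hj') hj']
  field_simp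
  ring

lemma sum_o1 {x : ℝ} (hx : x ∈ Ioo (0 : ℝ) 1) :
    HasSum (fun j : ℕ => W ((true, true), j) x) (√3 / (1 + √3 * x) - 1 / (1 + x)) := by
  have hlim := @tend_moeb (1 + √3) (2 * (1 + √3) + 1) ((1 + √3) * (1 + x))
    ((2 * (1 + √3) + 1) * x + (2 * (1 + √3) - √3))
    (mul_pos (by positivity) (by linarith [hx.1]))
  have h := @hasSum_tele (fun j : ℕ => W ((true, true), j) x) _ _ ?_ (fun j => W_nonneg _ hx) hlim
  · convert h using 1
    obtain ⟨h0, h1⟩ := hx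
    obtain ⟨b, hb, hb2, hb3, hb4⟩ := s3_prop
    rw [hb]
    have e2 : (1 + b) / ((1 + b) * (1 + x)) = 1 / (1 + x) := by
      have : 1 + b ≠ 0 := by linarith
      have : 1 + x ≠ 0 := by linarith
      field_simp
    rw [e2]
    congr 1
    push_cast
    rw [div_eq_div_iff (by positivity) (by nlinarith)]
    linear_combination hb2
  · intro j
    have hj : (0 : ℝ) ≤ j := Nat.cast_nonneg j
    obtain ⟨h0, h1⟩ := hx
    simp only [W, den1, den2, al, be, ga, de]
    obtain ⟨b, hb, hb2, hb3, hb4⟩ := s3_prop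
    rw [hb]
    push_cast
    have hb0 : 0 < b := by linarith
    have hb1 : 0 < 2 - b := by linarith
    have hjb := mul_nonneg hj hb0.le
    have hjx := mul_nonneg hj h0.le
    have hjbx := mul_nonneg hjb h0.le
    have P1 : 0 < (1 + b) * (1 + x) * (j : ℝ) + ((2 * (1 + b) + 1) * x + (2 * (1 + b) - b)) := by
      have : 0 < (2 * (1 + b) - b) := by linarith
      positivity
    have P2 : 0 < (1 + b) * (1 + x) * ((j : ℝ) + 1) + ((2 * (1 + b) + 1) * x + (2 * (1 + b) - b)) := by
      have : 0 < (2 * (1 + b) - b) := by linarith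
      positivity
    have P3 : 0 < ((j : ℝ) + 3) * x + (j + 2) - (2 - b) * ((j + 2) * x + (j + 1)) := by nlinarith
    have P4 : 0 < ((j : ℝ) + 3) * x + (j + 2) + b * ((j + 2) * x + (j + 1)) := by positivity
    rw [div_sub_div _ _ P1.ne' P2.ne', div_eq_div_iff (mul_pos P3 P4).ne' (mul_pos P1 P2).ne']
    have Q : (1 + b) * (1 + x) * ((j : ℝ) + 1) + ((2 * (1 + b) + 1) * x + (2 * (1 + b) - b)) =
        (2 + b) * (((j : ℝ) + 3) * x + (j + 2) - (2 - b) * ((j + 2) * x + (j + 1))) := by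
      linear_combination ((j + 2) * x + (j + 1)) * hb2 * (-1)
    have Q2 : (1 + b) * (1 + x) * (j : ℝ) + ((2 * (1 + b) + 1) * x + (2 * (1 + b) - b)) =
        ((j : ℝ) + 3) * x + (j + 2) + b * ((j + 2) * x + (j + 1)) := by ring
    rw [Q2, Q]
    generalize hA : ((j : ℝ) + 3) * x + (j + 2) - (2 - b) * ((j + 2) * x + (j + 1)) = A
    generalize hB : ((j : ℝ) + 3) * x + (j + 2) + b * ((j + 2) * x + (j + 1)) = B
    have R : ((1 + b) * (j : ℝ) + (2 * (1 + b) + 1)) * ((2 + b) * A) -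
        B * ((1 + b) * ((j : ℝ) + 1) + (2 * (1 + b) + 1)) = 2 * (2 + b) := by
      rw [← hA, ← Q, ← hB, ← Q2]
      linear_combination hb2
    rw [R]
    ring

lemma sum_o0 {x : ℝ} (hx : x ∈ Ioo (0 : ℝ) 1) :
    HasSum (fun j : ℕ => W ((true, false), j) x) (1 / (1 + x) - 1 / (√3 + x)) := by
  have hlim := @tend_moeb (-(1 + √3)) (-(2 * (1 + √3) - √3)) ((1 + √3) * (1 + x))
    ((2 * (1 + √3) - √3) * x + (2 * (1 + √3) + 1))
    (mul_pos (by positivity) (by linarith [hx.1]))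
  have h := @hasSum_tele (fun j : ℕ => W ((true, false), j) x) _ _ ?_ (fun j => W_nonneg _ hx) hlim
  · convert h using 1
    obtain ⟨h0, h1⟩ := hx
    obtain ⟨b, hb, hb2, hb3, hb4⟩ := s3_prop
    rw [hb]
    have e2 : -(1 + b) / ((1 + b) * (1 + x)) = -(1 / (1 + x)) := by
      have : 1 + b ≠ 0 := by linarith
      have : 1 + x ≠ 0 := by linarith
      field_simp
    rw [e2]
    have e3 : (-(1 + b) * ((0 : ℕ) : ℝ) + -(2 * (1 + b) - b)) /
        ((1 + b) * (1 + x) * ((0 : ℕ) : ℝ) + ((2 * (1 + b) - b) * x + (2 * (1 + b) + 1))) =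
        -(1 / (b + x)) := by
      push_cast
      rw [← neg_div, div_eq_div_iff (by nlinarith) (by positivity)]
      linear_combination (-1) * hb2
    rw [e3]
    ring
  · intro j
    have hj : (0 : ℝ) ≤ j := Nat.cast_nonneg j
    obtain ⟨h0, h1⟩ := hx
    simp only [W, den1, den2, al, be, ga, de]
    obtain ⟨b, hb, hb2, hb3, hb4⟩ := s3_prop
    rw [hb]
    push_cast
    have hb0 : 0 < b := by linarith
    have hjx := mul_nonneg hj h0.le
    have hn : 0 < (2 * (1 + b) - b) := by linarith
    have P1 : 0 < (1 + b) * (1 + x) * (j : ℝ) + ((2 * (1 + b) - b) * x + (2 * (1 + b) + 1)) := by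
      positivity
    have P2 : 0 < (1 + b) * (1 + x) * ((j : ℝ) + 1) +
        ((2 * (1 + b) - b) * x + (2 * (1 + b) + 1)) := by
      positivity
    have Q : (1 + b) * (1 + x) * ((j : ℝ) + 1) + ((2 * (1 + b) - b) * x + (2 * (1 + b) + 1)) =
        (2 + b) * (((j : ℝ) + 2) * x + (j + 3) - (2 - b) * ((j + 1) * x + (j + 2))) := by
      linear_combination ((j + 1) * x + (j + 2)) * hb2 * (-1)
    have P3 : 0 < ((j : ℝ) + 2) * x + (j + 3) - (2 - b) * ((j + 1) * x + (j + 2)) := by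
      rw [Q] at P2
      exact pos_of_mul_pos_right P2 (by linarith)
    have P4 : 0 < ((j : ℝ) + 2) * x + (j + 3) + b * ((j + 1) * x + (j + 2)) := by positivity
    rw [div_sub_div _ _ P1.ne' P2.ne', div_eq_div_iff (mul_pos P3 P4).ne' (mul_pos P1 P2).ne']
    have Q2 : (1 + b) * (1 + x) * (j : ℝ) + ((2 * (1 + b) - b) * x + (2 * (1 + b) + 1)) =
        ((j : ℝ) + 2) * x + (j + 3) + b * ((j + 1) * x + (j + 2)) := by ring
    rw [Q2, Q]
    generalize hA : ((j : ℝ) + 2) * x + (j + 3) - (2 - b) * ((j + 1) * x + (j + 2)) = A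
    generalize hB : ((j : ℝ) + 2) * x + (j + 3) + b * ((j + 1) * x + (j + 2)) = B
    have R : (-(1 + b) * (j : ℝ) + -(2 * (1 + b) - b)) * ((2 + b) * A) -
        B * (-(1 + b) * ((j : ℝ) + 1) + -(2 * (1 + b) - b)) = 2 * (2 + b) := by
      rw [← hA, ← Q, ← hB, ← Q2]
      linear_combination hb2
    rw [R]
    ring

lemma sum_W {x : ℝ} (hx : x ∈ Ioo (0 : ℝ) 1) :
    ∑' i : Ix, ENNReal.ofReal (wt i x) = 1 := by
  have hr1 := r1_pos hx
  have hr2 := r2_pos hx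
  have hw : ∀ i : Ix, ENNReal.ofReal (wt i x) =
      ENNReal.ofReal (r1 x * r2 x / 2) * ENNReal.ofReal (W i x) := by
    intro i
    rw [← ENNReal.ofReal_mul (by positivity)]
    congr 1
    unfold wt W
    ring
  have key : ∀ (p : Bool × Bool) (v : ℝ), HasSum (fun j : ℕ => W (p, j) x) v →
      ∑' j : ℕ, ENNReal.ofReal (W (p, j) x) = ENNReal.ofReal v := by
    intro p v hv
    rw [← ENNReal.ofReal_tsum_of_nonneg (fun j => W_nonneg _ hx) hv.summable, hv.tsum_eq]
  simp only [hw]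
  rw [ENNReal.tsum_mul_left, ENNReal.tsum_prod', tsum_fintype]
  rw [Fintype.sum_prod_type]
  simp only [Fintype.sum_bool]
  have n1 := (sum_o1 hx).nonneg (fun j => W_nonneg _ hx)
  have n2 := (sum_o0 hx).nonneg (fun j => W_nonneg _ hx)
  have n3 := (sum_e1 hx).nonneg (fun j => W_nonneg _ hx)
  have n4 := (sum_e0 hx).nonneg (fun j => W_nonneg _ hx)
  rw [key _ _ (sum_o1 hx), key _ _ (sum_o0 hx), key _ _ (sum_e1 hx), key _ _ (sum_e0 hx),
    ← ENNReal.ofReal_add n1 n2, ← ENNReal.ofReal_add n3 n4,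
    ← ENNReal.ofReal_add (add_nonneg n1 n2) (add_nonneg n3 n4),
    ← ENNReal.ofReal_mul (by positivity), ← ENNReal.ofReal_one]
  congr 1
  unfold r1 r2 at *
  obtain ⟨h0, h1⟩ := hx
  obtain ⟨b, hb, hb2, hb3, hb4⟩ := s3_prop
  rw [hb] at hr1 hr2 ⊢
  have e1 : 1 / (2 + b - x) = (2 - b) / (1 - (2 - b) * x) := by
    rw [div_eq_div_iff (by linarith) (by linarith)]
    linear_combination hb2
  rw [e1]
  have g1 := hr1.ne'
  have g2 := hr2.ne'
  have e2 : b / (1 + b * x) - 1 / (1 + x) + (1 / (1 + x) - 1 / (b + x)) +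
      ((2 - b) / (1 - (2 - b) * x) + 1 / (b + x)) =
      b / (1 + b * x) + (2 - b) / (1 - (2 - b) * x) := by ring
  rw [e2, div_add_div _ _ g2 g1, div_mul_div_comm, div_eq_one_iff_eq (by positivity)]
  ring

/-! ### The invariant measure -/

lemma logc_pos : 0 < Real.log (2 + √3) := Real.log_pos (by linarith [s3_gt])

lemma fdens_meas : Measurable fdens := by unfold fdens; fun_prop

lemma fdens_eq (x : ℝ) : fdens x = 2 / (Real.log (2 + √3) * (r1 x * r2 x)) := by
  unfold fdens r1 r2
  rw [mul_assoc]

lemma fdens_pos {x : ℝ} (hx : x ∈ Ioo (0 : ℝ) 1) : 0 < fdens x := by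
  rw [fdens_eq]
  have := r1_pos hx
  have := r2_pos hx
  have := logc_pos
  positivity

lemma fdens_hh (i : Ix) {x : ℝ} (hx : x ∈ Ioo (0 : ℝ) 1) :
    |(al i * de i - be i * ga i) / (ga i * x + de i) ^ 2| * fdens (hh i x) = fdens x * wt i x := by
  have h1 := den_ge i hx.1.le hx.2.le
  have hd : ga i * x + de i ≠ 0 := by linarith
  rw [abs_div, det_sq, abs_of_nonneg (sq_nonneg _), fdens_eq, fdens_eq, wt]
  have e1 : r1 (hh i x) = den1 i x / (ga i * x + de i) := by
    unfold r1 den1 hh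
    rw [← mul_div_assoc, one_sub_div hd]
  have e2 : r2 (hh i x) = den2 i x / (ga i * x + de i) := by
    unfold r2 den2 hh
    rw [← mul_div_assoc, one_add_div hd]
  have p1 := (r1_pos hx).ne'
  have p2 := (r2_pos hx).ne'
  have p3 := (den1_pos i hx).ne'
  have p4 := (den2_pos i hx).ne'
  have p5 := logc_pos.ne'
  rw [e1, e2]
  generalize ga i * x + de i = D at *
  field_simp

lemma T_meas : Measurable T := by
  have h1 : Measurable Te := by
    unfold Te
    have : Measurable fun y : ℝ => ((⌊(1 / y + 1) / 2⌋ : ℤ) : ℝ) := by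
      apply Measurable.comp (measurable_from_top (f := fun n : ℤ => (n : ℝ)))
      exact Int.measurable_floor.comp (by fun_prop)
    have h2 : Measurable fun y : ℝ => 1 / y - 2 * ((⌊(1 / y + 1) / 2⌋ : ℤ) : ℝ) := by fun_prop
    exact continuous_abs.measurable.comp h2
  have h2 : Measurable iota := by unfold iota; fun_prop
  unfold T
  refine Measurable.ite measurableSet_Iic measurable_const ?_
  refine Measurable.ite measurableSet_Ici measurable_const ?_
  exact Measurable.ite measurableSet_Iic h1 (h2.comp (h1.comp h2))

lemma lint_mu {F : ℝ → ENNReal} (hF : Measurable F) :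
    ∫⁻ x, F x ∂mu = ∫⁻ x in Ioo (0 : ℝ) 1, ENNReal.ofReal (fdens x) * F x := by
  unfold mu
  rw [lintegral_withDensity_eq_lintegral_mul _ (fdens_meas.ennreal_ofReal) hF]
  rfl

lemma mu_ac : mu ≪ volume.restrict (Ioo (0 : ℝ) 1) := withDensity_absolutelyContinuous _ _

lemma ae_Ioo : ∀ᵐ x ∂mu, x ∈ Ioo (0 : ℝ) 1 :=
  mu_ac.ae_le (ae_restrict_mem measurableSet_Ioo)

lemma ae_irr : ∀ᵐ x ∂mu, x ∈ Ioo (0 : ℝ) 1 ∧ Irrational x := by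
  have h1 : ∀ᵐ x ∂(volume : Measure ℝ), Irrational x :=
    (countable_range ((↑) : ℚ → ℝ)).ae_notMem _
  filter_upwards [ae_Ioo, mu_ac.ae_le (ae_restrict_of_ae h1)] with x h h'
  exact ⟨h, h'⟩

lemma mu_univ : mu univ = 1 := by
  have h := lint_mu (F := fun _ => 1) measurable_const
  simp only [lintegral_one, mul_one] at h
  rw [h]
  have hr : ∀ x ∈ uIcc (0 : ℝ) 1, 0 < r1 x ∧ 0 < r2 x := by
    intro x hx
    rw [uIcc_of_le zero_le_one] at hx
    have := s3_gt; have := s3_lt; obtain ⟨h0, h1⟩ := hx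
    unfold r1 r2
    constructor <;> nlinarith
  have hc := logc_pos
  have hderiv : ∀ x ∈ uIcc (0 : ℝ) 1,
      HasDerivAt (fun x => (Real.log (r2 x) - Real.log (r1 x)) / Real.log (2 + √3)) (fdens x) x := by
    intro x hx
    obtain ⟨p1, p2⟩ := hr x hx
    have d1 : HasDerivAt r1 (-(2 - √3)) x := by
      exact (((hasDerivAt_id x).const_mul (2 - √3)).const_sub 1).congr_deriv (by ring)
    have d2 : HasDerivAt r2 (√3) x := by
      exact (((hasDerivAt_id x).const_mul (√3)).const_add 1).congr_deriv (by ring)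
    refine (((d2.log p2.ne').sub (d1.log p1.ne')).div_const _).congr_deriv ?_
    rw [fdens_eq, div_sub_div _ _ p2.ne' p1.ne', div_div]
    have e : √3 * r1 x - r2 x * -(2 - √3) = 2 := by unfold r1 r2; ring
    rw [e]
    congr 1
    ring
  have hcont : ContinuousOn fdens (uIcc (0 : ℝ) 1) := by
    have : fdens = fun x => 2 / (Real.log (2 + √3) * (r1 x * r2 x)) := funext fdens_eq
    rw [this]
    apply ContinuousOn.div continuousOn_const
    · unfold r1 r2; fun_prop
    · intro x hx
      obtain ⟨p1, p2⟩ := hr x hx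
      positivity
  have hInt : IntervalIntegrable fdens volume 0 1 := hcont.intervalIntegrable
  have hI := intervalIntegral.integral_eq_sub_of_hasDerivAt hderiv hInt
  have hv : ∫ x in (0 : ℝ)..1, fdens x = 1 := by
    rw [hI, ← sub_div, div_eq_one_iff_eq hc.ne']
    have z1 : r1 0 = 1 := by simp [r1]
    have z2 : r2 0 = 1 := by simp [r2]
    rw [z1, z2, Real.log_one, sub_self, sub_zero]
    obtain ⟨p1, p2⟩ := hr 1 (by simp)
    rw [← Real.log_div p2.ne' p1.ne']
    congr 1
    rw [div_eq_iff p1.ne']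
    unfold r1 r2
    linear_combination (-1) * s3_sq
  rw [intervalIntegral.integral_of_le zero_le_one, integral_Ioc_eq_integral_Ioo] at hv
  rw [← ofReal_integral_eq_lintegral_ofReal, hv, ENNReal.ofReal_one]
  · rw [intervalIntegrable_iff_integrableOn_Ioo_of_le zero_le_one] at hInt
    exact hInt
  · filter_upwards [ae_restrict_mem measurableSet_Ioo] with x hx
    exact (fdens_pos hx).le

instance : IsProbabilityMeasure mu := ⟨mu_univ⟩

/-! ### Transfer operator -/

def HS (I : Set Ix) : Set ℝ := ⋃ i ∈ I, hh i '' Ioo (0 : ℝ) 1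

noncomputable def Pf (I : Set Ix) (f : ℝ → ENNReal) (x : ℝ) : ENNReal :=
  ∑' i : I, ENNReal.ofReal (wt i x) * f (hh i x)

lemma hh_injOn (i : Ix) : InjOn (hh i) (Ioo (0 : ℝ) 1) := by
  intro x hx y hy h
  rw [← T_hh i hx, ← T_hh i hy, h]

lemma img_meas (i : Ix) : MeasurableSet (hh i '' Ioo (0 : ℝ) 1) :=
  measurableSet_Ioo.image_of_measurable_injOn (hh_meas i) (hh_injOn i)

lemma HS_meas (I : Set Ix) : MeasurableSet (HS I) :=
  MeasurableSet.biUnion I.to_countable fun i _ => img_meas i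

lemma HS_sub (I : Set Ix) : HS I ⊆ Ioo (0 : ℝ) 1 := by
  refine iUnion₂_subset fun i _ => ?_
  rintro _ ⟨x, hx, rfl⟩
  exact hh_mem i hx

lemma wt_meas (i : Ix) : Measurable (wt i) := by
  unfold wt r1 r2 den1 den2; fun_prop

lemma Pf_meas (I : Set Ix) {f : ℝ → ENNReal} (hf : Measurable f) : Measurable (Pf I f) := by
  unfold Pf
  refine Measurable.tsum fun i => ?_
  exact (wt_meas i).ennreal_ofReal.mul (hf.comp (hh_meas i))

lemma transfer (I : Set Ix) {f Ψ : ℝ → ENNReal} (hf : Measurable f) (hΨ : Measurable Ψ) :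
    ∫⁻ x, (HS I).indicator f x * Ψ (T x) ∂mu = ∫⁻ x, Pf I f x * Ψ x ∂mu := by
  have hΨT : Measurable fun x => Ψ (T x) := hΨ.comp T_meas
  rw [lint_mu (F := fun x => (HS I).indicator f x * Ψ (T x))
      ((hf.indicator (HS_meas I)).mul hΨT),
    lint_mu (F := fun x => Pf I f x * Ψ x) ((Pf_meas I hf).mul hΨ)]
  have e1 : (fun x => ENNReal.ofReal (fdens x) * ((HS I).indicator f x * Ψ (T x))) =
      (HS I).indicator (fun x => ENNReal.ofReal (fdens x) * (f x * Ψ (T x))) := by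
    ext x
    by_cases hx : x ∈ HS I <;> simp [hx]
  rw [e1, lintegral_indicator (HS_meas I), Measure.restrict_restrict (HS_meas I),
    inter_eq_left.2 (HS_sub I)]
  unfold HS
  rw [lintegral_biUnion I.to_countable (fun i _ => img_meas i)]
  · have e2 : ∀ i : I, ∫⁻ x in hh i '' Ioo (0 : ℝ) 1, ENNReal.ofReal (fdens x) * (f x * Ψ (T x)) =
        ∫⁻ x in Ioo (0 : ℝ) 1, ENNReal.ofReal (fdens x) *
          ((ENNReal.ofReal (wt i x) * f (hh i x)) * Ψ x) := by
      intro i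
      rw [lintegral_image_eq_lintegral_abs_deriv_mul measurableSet_Ioo
        (fun x hx => (hh_deriv i hx).hasDerivWithinAt) (hh_injOn i)]
      refine setLIntegral_congr_fun measurableSet_Ioo fun x hx => ?_
      rw [T_hh i hx, ← mul_assoc, ← ENNReal.ofReal_mul (abs_nonneg _), fdens_hh i hx,
        ENNReal.ofReal_mul (fdens_pos hx).le]
      ring
    simp only [e2]
    rw [← lintegral_tsum]
    · congr 1
      ext x
      rw [ENNReal.tsum_mul_left, ENNReal.tsum_mul_right]
      rfl
    · intro i
      exact (fdens_meas.ennreal_ofReal.mul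
        (((wt_meas i).ennreal_ofReal.mul (hf.comp (hh_meas i))).mul hΨ)).aemeasurable
  · intro i _ i' _ hne
    rw [Function.onFun, Set.disjoint_left]
    rintro _ ⟨x, hx, rfl⟩ ⟨y, hy, h⟩
    exact hne (hh_inj hx hy h.symm)

lemma ae_HS : ∀ᵐ x ∂mu, x ∈ HS univ := by
  filter_upwards [ae_irr] with x hx
  obtain ⟨i, y, hy, h⟩ := exists_hh hx.1 hx.2
  exact mem_iUnion₂.2 ⟨i, mem_univ _, y, hy, h⟩

lemma transfer_univ {f Ψ : ℝ → ENNReal} (hf : Measurable f) (hΨ : Measurable Ψ) :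
    ∫⁻ x, f x * Ψ (T x) ∂mu = ∫⁻ x, Pf univ f x * Ψ x ∂mu := by
  rw [← transfer univ hf hΨ]
  refine lintegral_congr_ae ?_
  filter_upwards [ae_HS] with x hx
  rw [indicator_of_mem hx]

lemma Pf_one {x : ℝ} (hx : x ∈ Ioo (0 : ℝ) 1) : Pf univ (fun _ => 1) x = 1 := by
  unfold Pf
  simp only [mul_one]
  rw [tsum_univ (fun i : Ix => ENNReal.ofReal (wt i x))]
  exact sum_W hx

lemma invar {Ψ : ℝ → ENNReal} (hΨ : Measurable Ψ) :
    ∫⁻ x, Ψ (T x) ∂mu = ∫⁻ x, Ψ x ∂mu := by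
  have h := transfer_univ (f := fun _ => 1) measurable_const hΨ
  simp only [one_mul] at h
  rw [h]
  refine lintegral_congr_ae ?_
  filter_upwards [ae_Ioo] with x hx
  rw [Pf_one hx, one_mul]

lemma T_mp : MeasurePreserving T mu mu := by
  refine ⟨T_meas, ?_⟩
  ext s hs
  rw [Measure.map_apply T_meas hs, ← lintegral_indicator_one hs,
    ← lintegral_indicator_one (T_meas hs), ← invar (measurable_one.indicator hs)]
  rfl

/-! ### Regular functions -/

def Reg (K : ℝ) (f : ℝ → ENNReal) : Prop :=
  ∀ x ∈ Ioo (0 : ℝ) 1, ∀ y ∈ Ioo (0 : ℝ) 1,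
    f x ≤ ENNReal.ofReal (Real.exp (K * |x - y|)) * f y

lemma Reg_mono {K K' : ℝ} (h : K ≤ K') {f : ℝ → ENNReal} (hf : Reg K f) : Reg K' f := by
  intro x hx y hy
  refine (hf x hx y hy).trans ?_
  gcongr

lemma Reg_Pf (I : Set Ix) {f : ℝ → ENNReal} (hf : Reg 32 f) : Reg 16 (Pf I f) := by
  intro x hx y hy
  unfold Pf
  rw [← ENNReal.tsum_mul_left]
  refine ENNReal.tsum_le_tsum fun i => ?_
  have h1 := wt_dist i hx hy
  have h2 := hf _ (hh_mem i hx) _ (hh_mem i hy)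
  have h3 := hh_contr i hx hy
  calc ENNReal.ofReal (wt i x) * f (hh i x)
      ≤ ENNReal.ofReal (Real.exp (8 * |x - y|) * wt i y) *
        (ENNReal.ofReal (Real.exp (8 * |x - y|)) * f (hh i y)) := by
        refine mul_le_mul' (ENNReal.ofReal_le_ofReal h1) (h2.trans ?_)
        refine mul_le_mul' (ENNReal.ofReal_le_ofReal (Real.exp_le_exp.2 ?_)) le_rfl
        linarith
    _ = _ := by
        rw [ENNReal.ofReal_mul (Real.exp_pos _).le,
          show (16 : ℝ) * |x - y| = 8 * |x - y| + 8 * |x - y| by ring, Real.exp_add,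
          ENNReal.ofReal_mul (Real.exp_pos _).le]
        ring

lemma sub_aux {p q C : ENNReal} {E : ℝ} (hE : 1 ≤ E) (hC : C ≠ ⊤) (hq : q ≠ ⊤)
    (hpq : p ≤ ENNReal.ofReal E * q) (hCq : 2 * C ≤ q) :
    p - C ≤ ENNReal.ofReal (E * E) * (q - C) := by
  rw [tsub_le_iff_right]
  refine hpq.trans ?_
  lift C to NNReal using hC
  lift q to NNReal using hq
  have hE0 : 0 ≤ E := by linarith
  lift E to NNReal using hE0
  rw [← NNReal.coe_mul, ENNReal.ofReal_coe_nnreal, ENNReal.ofReal_coe_nnreal, ← ENNReal.coe_sub]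
  norm_cast at hCq ⊢
  have hle : C ≤ q := le_trans (by rw [two_mul]; exact le_add_self) hCq
  rw [← NNReal.coe_le_coe] at hCq ⊢
  push_cast [NNReal.coe_sub hle] at hCq ⊢
  nlinarith [mul_nonneg (sub_nonneg.2 hE) (mul_nonneg E.coe_nonneg (sub_nonneg.2 hCq)),
    mul_nonneg (sub_nonneg.2 hE) (mul_nonneg (sub_nonneg.2 hE) C.coe_nonneg)]

lemma abs_lt_one {x y : ℝ} (hx : x ∈ Ioo (0 : ℝ) 1) (hy : y ∈ Ioo (0 : ℝ) 1) :
    |x - y| ≤ 1 := by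
  rw [abs_le]; constructor <;> linarith [hx.1, hx.2, hy.1, hy.2]

lemma Reg_upper {f : ℝ → ENNReal} (hr : Reg 16 f) {x : ℝ} (hx : x ∈ Ioo (0 : ℝ) 1) :
    f x ≤ ENNReal.ofReal (Real.exp 16) * ∫⁻ y, f y ∂mu := by
  rw [← lintegral_const_mul' _ _ ENNReal.ofReal_ne_top]
  calc f x = ∫⁻ _, f x ∂mu := by simp
    _ ≤ _ := by
      refine lintegral_mono_ae ?_
      filter_upwards [ae_Ioo] with y hy
      refine (hr x hx y hy).trans ?_
      have := abs_lt_one hx hy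
      gcongr
      linarith

lemma Reg_lower {f : ℝ → ENNReal} (hr : Reg 16 f) {x : ℝ} (hx : x ∈ Ioo (0 : ℝ) 1) :
    ∫⁻ y, f y ∂mu ≤ ENNReal.ofReal (Real.exp 16) * f x := by
  calc _ ≤ ∫⁻ _, ENNReal.ofReal (Real.exp 16) * f x ∂mu := by
        refine lintegral_mono_ae ?_
        filter_upwards [ae_Ioo] with y hy
        refine (hr y hy x hx).trans ?_
        have := abs_lt_one hy hx
        gcongr
        linarith
    _ = _ := by simp

noncomputable def cc : ℝ := Real.exp (-16) / 2

lemma cc_pos : 0 < cc := by unfold cc; positivity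
lemma cc_lt : cc < 1 := by
  unfold cc
  have : Real.exp (-16) < 1 := Real.exp_lt_one_iff.2 (by norm_num)
  linarith

lemma mix (r : ℕ) {Ψ : ℝ → ENNReal} (hΨ : Measurable Ψ) :
    ∀ f : ℝ → ENNReal, Measurable f → Reg 16 f → ∫⁻ x, f x ∂mu ≠ ⊤ →
    ∫⁻ x, f x * Ψ (T^[r] x) ∂mu ≤
      ENNReal.ofReal (1 + Real.exp 16 * (1 - cc) ^ r) * (∫⁻ x, f x ∂mu) * ∫⁻ x, Ψ x ∂mu := by
  have hc0 := cc_pos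
  have hc1 := cc_lt
  induction r with
  | zero =>
    intro f hf hr hm
    simp only [Function.iterate_zero, id, pow_zero, mul_one]
    rw [← lintegral_const_mul _ hΨ]
    refine lintegral_mono_ae ?_
    filter_upwards [ae_Ioo] with x hx
    refine mul_le_mul' ((Reg_upper hr hx).trans ?_) le_rfl
    refine mul_le_mul' (ENNReal.ofReal_le_ofReal (by linarith)) le_rfl
  | succ r ih =>
    intro f hf hr hm
    set m := ∫⁻ x, f x ∂mu with hmdef
    have hCtop : ENNReal.ofReal cc * m ≠ ⊤ := ENNReal.mul_ne_top ENNReal.ofReal_ne_top hm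
    have h2C : ∀ x ∈ Ioo (0 : ℝ) 1, 2 * (ENNReal.ofReal cc * m) ≤ f x := by
      intro x hx
      calc 2 * (ENNReal.ofReal cc * m)
          ≤ 2 * (ENNReal.ofReal cc * (ENNReal.ofReal (Real.exp 16) * f x)) := by
            gcongr; exact Reg_lower hr hx
        _ = ENNReal.ofReal (2 * (cc * Real.exp 16)) * f x := by
            rw [ENNReal.ofReal_mul (by norm_num), ENNReal.ofReal_mul hc0.le]
            rw [show ENNReal.ofReal 2 = 2 by norm_num]
            ring
        _ = f x := by
            have : 2 * (cc * Real.exp 16) = 1 := by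
              unfold cc
              rw [Real.exp_neg]
              field_simp
            rw [this]; simp
    generalize hC : ENNReal.ofReal cc * m = C at *
    have hfin : ∀ x ∈ Ioo (0 : ℝ) 1, f x ≠ ⊤ := fun x hx =>
      ne_top_of_le_ne_top (ENNReal.mul_ne_top ENNReal.ofReal_ne_top hm) (Reg_upper hr hx)
    have hgm : Measurable fun x => f x - C := hf.sub_const C
    have hgr : Reg 32 fun x => f x - C := by
      intro x hx y hy
      have := sub_aux (E := Real.exp (16 * |x - y|)) (Real.one_le_exp (by positivity)) hCtop
        (hfin y hy) (hr x hx y hy) (h2C y hy)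
      rw [← Real.exp_add, show 16 * |x - y| + 16 * |x - y| = 32 * |x - y| by ring] at this
      exact this
    have hsplit : ∀ᵐ x ∂mu, f x = C + (f x - C) := by
      filter_upwards [ae_Ioo] with x hx
      rw [add_tsub_cancel_of_le]
      refine le_trans ?_ (h2C x hx)
      rw [two_mul]; exact le_self_add
    have hPint : ∫⁻ x, Pf univ (fun x => f x - C) x ∂mu = ∫⁻ x, (f x - C) ∂mu := by
      have := transfer_univ (Ψ := fun _ => 1) hgm measurable_const
      simpa using this.symm
    have hG : ∫⁻ x, (f x - C) ∂mu = ENNReal.ofReal (1 - cc) * m := by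
      have h1 : C + ∫⁻ x, (f x - C) ∂mu = m := by
        rw [hmdef, lintegral_congr_ae hsplit, lintegral_add_left measurable_const]
        simp
      have h2 : C + ENNReal.ofReal (1 - cc) * m = m := by
        rw [← hC, ← add_mul, ← ENNReal.ofReal_add hc0.le (by linarith)]
        simp
      exact (ENNReal.add_right_inj hCtop).1 (h1.trans h2.symm)
    have hΨr : Measurable fun x => Ψ (T^[r] x) := hΨ.comp (T_meas.iterate r)
    have hΨr1 : Measurable fun x => Ψ (T^[r + 1] x) := hΨ.comp (T_meas.iterate (r + 1))
    have hinv : ∫⁻ x, Ψ (T^[r + 1] x) ∂mu = ∫⁻ x, Ψ x ∂mu :=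
      (T_mp.iterate (r + 1)).lintegral_comp hΨ
    have hstep := ih _ (Pf_meas univ hgm) (Reg_Pf univ hgr)
      (by rw [hPint, hG]; exact ENNReal.mul_ne_top ENNReal.ofReal_ne_top hm)
    rw [← transfer_univ hgm hΨr, hPint, hG] at hstep
    have hlhs : ∫⁻ x, f x * Ψ (T^[r + 1] x) ∂mu =
        C * ∫⁻ x, Ψ x ∂mu + ∫⁻ x, (f x - C) * Ψ (T^[r] (T x)) ∂mu := by
      rw [← hinv, ← lintegral_const_mul _ hΨr1, ← lintegral_add_left (hΨr1.const_mul C)]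
      refine lintegral_congr_ae ?_
      filter_upwards [hsplit] with x hx
      rw [← Function.iterate_succ_apply, ← add_mul, ← hx]
    rw [hlhs]
    have hθ : 0 ≤ 1 - cc := by linarith
    refine (add_le_add le_rfl hstep).trans (le_of_eq ?_)
    have hcoef : 1 + Real.exp 16 * (1 - cc) ^ (r + 1) =
        cc + (1 + Real.exp 16 * (1 - cc) ^ r) * (1 - cc) := by ring
    rw [hcoef, ENNReal.ofReal_add hc0.le (by positivity), ENNReal.ofReal_mul (by positivity), ← hC]
    ring

lemma initial_reg (I : Set Ix) (S : ℕ → Prop) (N : ℕ) :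
    ∃ g : ℝ → ENNReal, Measurable g ∧ Reg 16 g ∧ ∀ Ψ : ℝ → ENNReal, Measurable Ψ →
      ∫⁻ x, ({x | ∀ n < N, S n → T^[n] x ∈ HS I}).indicator 1 x * Ψ (T^[N] x) ∂mu =
        ∫⁻ x, g x * Ψ x ∂mu := by
  induction N with
  | zero =>
    refine ⟨fun _ => 1, measurable_const, ?_, ?_⟩
    · intro x _ y _
      rw [mul_one, ← ENNReal.ofReal_one]
      exact ENNReal.ofReal_le_ofReal (Real.one_le_exp (by positivity))
    · intro Ψ _
      simp
  | succ N ih =>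
    obtain ⟨g, hg, hgr, hgi⟩ := ih
    have hgr' : Reg 32 g := Reg_mono (by norm_num) hgr
    by_cases hS : S N
    · refine ⟨Pf I g, Pf_meas I hg, Reg_Pf I hgr', fun Ψ hΨ => ?_⟩
      rw [← transfer I hg hΨ]
      have h1 := hgi (fun z => (HS I).indicator 1 z * Ψ (T z))
        ((measurable_one.indicator (HS_meas I)).mul (hΨ.comp T_meas))
      have h2 : ∀ z, (HS I).indicator g z * Ψ (T z) =
          g z * ((HS I).indicator 1 z * Ψ (T z)) := by
        intro z
        by_cases hz : z ∈ HS I <;> simp [hz]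
      simp only [h2]
      rw [← h1]
      congr 1
      ext x
      rw [← Function.iterate_succ_apply' T N x, ← mul_assoc]
      congr 1
      by_cases hA : ∀ n < N, S n → T^[n] x ∈ HS I
      · by_cases hB : T^[N] x ∈ HS I
        · have hC : x ∈ {x | ∀ n < N + 1, S n → T^[n] x ∈ HS I} := by
            intro n hn hs
            rcases Nat.lt_succ_iff_lt_or_eq.1 hn with h | rfl
            · exact hA n h hs
            · exact hB
          rw [indicator_of_mem hC, indicator_of_mem (by exact hA), indicator_of_mem hB]
          simp
        · have hC : x ∉ {x | ∀ n < N + 1, S n → T^[n] x ∈ HS I} := fun h =>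
            hB (h N (Nat.lt_succ_self N) hS)
          rw [indicator_of_notMem hC, indicator_of_notMem hB, mul_zero]
      · have hC : x ∉ {x | ∀ n < N + 1, S n → T^[n] x ∈ HS I} := fun h =>
            hA fun n hn => h n (Nat.lt_succ_of_lt hn)
        rw [indicator_of_notMem hC, indicator_of_notMem (by exact hA), zero_mul]
    · refine ⟨Pf univ g, Pf_meas univ hg, Reg_Pf univ hgr', fun Ψ hΨ => ?_⟩
      rw [← transfer_univ hg hΨ, ← hgi (fun z => Ψ (T z)) (hΨ.comp T_meas)]
      have : {x | ∀ n < N + 1, S n → T^[n] x ∈ HS I} = {x | ∀ n < N, S n → T^[n] x ∈ HS I} := by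
        ext x
        refine ⟨fun h n hn => h n (Nat.lt_succ_of_lt hn), fun h n hn hs => ?_⟩
        rcases Nat.lt_succ_iff_lt_or_eq.1 hn with h' | rfl
        · exact h n h' hs
        · exact absurd hs hS
      rw [this]
      simp only [Function.iterate_succ_apply']

/-! ### Product estimate -/

lemma quasi (I : Set Ix) (n : ℕ → ℕ) (k : ℕ) (hn : ∀ j, j + 1 < k + 1 → n j < n (j + 1)) :
    mu {x | ∀ j < k + 1, T^[n j] x ∈ HS I} ≤
      ENNReal.ofReal (∏ j ∈ Finset.range k,
        (1 + Real.exp 16 / (1 - cc) * (1 - cc) ^ (n (j + 1) - n j))) * mu (HS I) ^ (k + 1) := by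
  have hc0 := cc_pos
  have hc1 := cc_lt
  have hθ : 0 < 1 - cc := by linarith
  induction k with
  | zero =>
    have : {x | ∀ j < 0 + 1, T^[n j] x ∈ HS I} = T^[n 0] ⁻¹' (HS I) := by
      ext x
      simp
    rw [this, (T_mp.iterate (n 0)).measure_preimage (HS_meas I).nullMeasurableSet]
    simp
  | succ k ih =>
    have ih' := ih fun j hj => hn j (by omega)
    have hmono : ∀ j ≤ k, n j ≤ n k := by
      intro j hj
      induction k with
      | zero => rw [Nat.le_zero.1 hj]
      | succ q hq =>
        clear ih ih'
        have aux : ∀ t, t ≤ q + 1 → j ≤ t → n j ≤ n t := by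
          intro t
          induction t with
          | zero => intro _ h; rw [Nat.le_zero.1 h]
          | succ t iht =>
            intro h1 h2
            rcases Nat.le_succ_iff.1 h2 with h | h
            · exact (iht (by omega) h).trans (hn t (by omega)).le
            · rw [h]
        exact aux _ le_rfl hj
    set S : ℕ → Prop := fun q => ∃ j ≤ k, n j = q with hS
    obtain ⟨g, hg, hgr, hgi⟩ := initial_reg I S (n k + 1)
    have hE : {x | ∀ q < n k + 1, S q → T^[q] x ∈ HS I} = {x | ∀ j < k + 1, T^[n j] x ∈ HS I} := by
      ext x
      constructor
      · intro h j hj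
        exact h (n j) (Nat.lt_succ_of_le (hmono j (by omega))) ⟨j, by omega, rfl⟩
      · rintro h q hq ⟨j, hj, rfl⟩
        exact h j (by omega)
    rw [hE] at hgi
    have hEm : MeasurableSet {x | ∀ j < k + 1, T^[n j] x ∈ HS I} := by
      simp only [ofPred_forall]
      exact MeasurableSet.iInter fun j => MeasurableSet.iInter fun _ =>
        (T_meas.iterate (n j)) (HS_meas I)
    have hgint : ∫⁻ x, g x ∂mu = mu {x | ∀ j < k + 1, T^[n j] x ∈ HS I} := by
      have := hgi (fun _ => 1) measurable_const
      simp only [mul_one] at this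
      rw [← this, lintegral_indicator_one hEm]
    have hlt := hn k (by omega)
    obtain ⟨r, hr⟩ : ∃ r, n (k + 1) = r + (n k + 1) := ⟨n (k + 1) - (n k + 1), by omega⟩
    have hmix := mix r (measurable_one.indicator (HS_meas I)) g hg hgr
      (by rw [hgint]; exact measure_ne_top _ _)
    rw [← hgi (fun x => (HS I).indicator 1 (T^[r] x))
      ((measurable_one.indicator (HS_meas I)).comp (T_meas.iterate r)), hgint,
      lintegral_indicator_one (HS_meas I)] at hmix
    have hEm' : MeasurableSet {x | ∀ j < k + 1 + 1, T^[n j] x ∈ HS I} := by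
      simp only [ofPred_forall]
      exact MeasurableSet.iInter fun j => MeasurableSet.iInter fun _ =>
        (T_meas.iterate (n j)) (HS_meas I)
    have hL : mu {x | ∀ j < k + 1 + 1, T^[n j] x ∈ HS I} =
        ∫⁻ x, ({x | ∀ j < k + 1, T^[n j] x ∈ HS I}).indicator 1 x *
          (HS I).indicator 1 (T^[r] (T^[n k + 1] x)) ∂mu := by
      rw [← lintegral_indicator_one hEm']
      congr 1
      ext x
      rw [← Function.iterate_add_apply, ← hr]
      by_cases hA : ∀ j < k + 1, T^[n j] x ∈ HS I
      · by_cases hB : T^[n (k + 1)] x ∈ HS I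
        · have hC : x ∈ {x | ∀ j < k + 1 + 1, T^[n j] x ∈ HS I} := by
            intro j hj
            rcases Nat.lt_succ_iff_lt_or_eq.1 hj with h | rfl
            · exact hA j h
            · exact hB
          rw [indicator_of_mem hC, indicator_of_mem (by exact hA), indicator_of_mem hB]
          simp
        · have hC : x ∉ {x | ∀ j < k + 1 + 1, T^[n j] x ∈ HS I} := fun h =>
            hB (h _ (Nat.lt_succ_self _))
          rw [indicator_of_notMem hC, indicator_of_notMem hB, mul_zero]
      · have hC : x ∉ {x | ∀ j < k + 1 + 1, T^[n j] x ∈ HS I} := fun h =>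
            hA fun j hj => h j (Nat.lt_succ_of_lt hj)
        rw [indicator_of_notMem hC, indicator_of_notMem (by exact hA), zero_mul]
    rw [hL]
    refine hmix.trans ?_
    have hcoef : 1 + Real.exp 16 * (1 - cc) ^ r =
        1 + Real.exp 16 / (1 - cc) * (1 - cc) ^ (n (k + 1) - n k) := by
      have : n (k + 1) - n k = r + 1 := by omega
      rw [this, pow_succ]
      field_simp
    rw [hcoef, Finset.prod_range_succ, mul_comm (∏ j ∈ Finset.range k, _),
      ENNReal.ofReal_mul (by positivity), pow_succ]
    calc _ ≤ _ := mul_le_mul' (mul_le_mul' le_rfl ih') le_rfl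
      _ = _ := by ring

lemma digit_iff (L : ℝ) {y : ℝ} (hy : y ∈ Ioo (0 : ℝ) 1) (hirr : Irrational y) :
    L < ((digit y).a : ℝ) ↔ y ∈ HS {i | L < (kk i : ℝ)} := by
  constructor
  · intro h
    obtain ⟨i, x, hx, rfl⟩ := exists_hh hy hirr
    rw [digit_hh i hx] at h
    exact mem_iUnion₂.2 ⟨i, by simpa using h, x, hx, rfl⟩
  · intro h
    obtain ⟨i, hi, x, hx, rfl⟩ := mem_iUnion₂.1 h
    rw [digit_hh i hx]
    simpa using hi

lemma ae_orbit : ∀ᵐ x ∂mu, ∀ n : ℕ, T^[n] x ∈ Ioo (0 : ℝ) 1 ∧ Irrational (T^[n] x) := by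
  rw [ae_all_iff]
  intro n
  exact (T_mp.iterate n).quasiMeasurePreserving.ae ae_irr

/-- quasi-independence of the events `{a_{i_j} > L}`. -/
theorem digits_quasi_independent :
    ∃ C₁ : ℝ, 0 < C₁ ∧ ∃ θ : ℝ, θ ∈ Set.Ioo (0 : ℝ) 1 ∧
      ∀ k : ℕ, 2 ≤ k → ∀ L : ℝ, 1 ≤ L → ∀ i : ℕ → ℕ,
        1 ≤ i 0 → (∀ j : ℕ, j + 1 < k → i j < i (j + 1)) →
        mu {x : ℝ | x ∈ Set.Ioo (0 : ℝ) 1 ∧ Irrational x ∧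
              ∀ j < k, L < (a (i j) x : ℝ)} ≤
          ENNReal.ofReal (∏ j ∈ Finset.range (k - 1), (1 + C₁ * θ ^ (i (j + 1) - i j))) *
            ∏ j ∈ Finset.range k,
              mu {x : ℝ | x ∈ Set.Ioo (0 : ℝ) 1 ∧ Irrational x ∧ L < (a (i j) x : ℝ)} := by
  have hc0 := cc_pos
  have hc1 := cc_lt
  refine ⟨Real.exp 16 / (1 - cc), div_pos (Real.exp_pos _) (by linarith), 1 - cc,
    ⟨by linarith, by linarith⟩, ?_⟩
  intro k hk L _ i hi0 hi
  obtain ⟨k, rfl⟩ : ∃ q, k = q + 1 := ⟨k - 1, by omega⟩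
  have hpos : ∀ j, j < k + 1 → 1 ≤ i j := by
    intro j
    induction j with
    | zero => intro _; exact hi0
    | succ j ih => intro h; have := hi j h; omega
  set I : Set Ix := {q | L < (kk q : ℝ)} with hI
  have e1 : mu {x : ℝ | x ∈ Set.Ioo (0 : ℝ) 1 ∧ Irrational x ∧ ∀ j < k + 1, L < (a (i j) x : ℝ)} =
      mu {x | ∀ j < k + 1, T^[i j - 1] x ∈ HS I} := by
    refine measure_congr ?_
    filter_upwards [ae_orbit] with x hx
    apply propext
    have h0 := hx 0
    constructor
    · rintro ⟨_, _, h⟩ j hj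
      exact (digit_iff L (hx _).1 (hx _).2).1 (h j hj)
    · intro h
      exact ⟨h0.1, h0.2, fun j hj => (digit_iff L (hx _).1 (hx _).2).2 (h j hj)⟩
  have e2 : ∀ n : ℕ, mu {x : ℝ | x ∈ Set.Ioo (0 : ℝ) 1 ∧ Irrational x ∧ L < (a n x : ℝ)} =
      mu (HS I) := by
    intro n
    rw [← (T_mp.iterate (n - 1)).measure_preimage (HS_meas I).nullMeasurableSet]
    refine measure_congr ?_
    filter_upwards [ae_orbit] with x hx
    apply propext
    have h0 := hx 0
    constructor
    · rintro ⟨_, _, h⟩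
      exact (digit_iff L (hx _).1 (hx _).2).1 h
    · intro h
      exact ⟨h0.1, h0.2, (digit_iff L (hx _).1 (hx _).2).2 h⟩
  rw [e1]
  simp only [e2, Finset.prod_const, Finset.card_range, Nat.add_sub_cancel]
  refine (quasi I (fun j => i j - 1) k ?_).trans (le_of_eq ?_)
  · intro j hj
    have h1 := hi j hj
    have h2 := hpos j (by omega)
    show i j - 1 < i (j + 1) - 1
    omega
  · congr 2
    refine Finset.prod_congr rfl fun j hj => ?_
    have h1 := hi j (by simpa using hj)
    have h2 := hpos j (by have := Finset.mem_range.1 hj; omega)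
    have : i (j + 1) - 1 - (i j - 1) = i (j + 1) - i j := by omega
    rw [this]

end SCF
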